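/- arXiv:2605.09957 — 2 statements merged into one kernel-verified Lean document; each statement's English description precedes it below -/
import Mathlib

section
/- Set t = ⌈√d⌉ and k = 100000. Consider the two-stage experiment: sample ψ uniformly from the unit sphere of ℂ^d, then sample kt values x_i^{(r)} ∈ {1,…,d} independently from the Born distribution p_ψ(x) = |ψ_x|²; let M be the block-averaged collision count. Then there exists d₀ such that for all d ≥ d₀, the probability that |M − C(t,2)·2/(d+1)| ≤ 1/4 is at least 0.99, where C(t,2) is the binomial coefficient 't choose 2'. -/
open MeasureTheory

noncomputable section

/-- The unit sphere of `ℂ^d`. -/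
abbrev unitSphere (d : ℕ) : Type := Metric.sphere (0 : EuclideanSpace ℂ (Fin d)) 1

/-- The action of a (complex-linear) isometric equivalence of `ℂ^d` on the unit sphere. -/
def sphereMap (d : ℕ) (U : EuclideanSpace ℂ (Fin d) ≃ₗᵢ[ℂ] EuclideanSpace ℂ (Fin d))
    (ψ : unitSphere d) : unitSphere d :=
  ⟨U ψ.1, by
    have hψ : ‖(ψ : EuclideanSpace ℂ (Fin d))‖ = 1 := by
      simpa [mem_sphere_iff_norm] using ψ.2

    simp [mem_sphere_iff_norm, U.norm_map, hψ]⟩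

instance (d : ℕ) : MeasurableSpace (EuclideanSpace ℂ (Fin d)) := borel _
instance (d : ℕ) : BorelSpace (EuclideanSpace ℂ (Fin d)) := ⟨rfl⟩

/-- `σ` is the rotation-invariant (uniform) probability measure on the unit sphere of `ℂ^d`. -/
def IsUniformSphereMeasure (d : ℕ) (σ : Measure (unitSphere d)) : Prop :=
  IsProbabilityMeasure σ ∧
    ∀ U : EuclideanSpace ℂ (Fin d) ≃ₗᵢ[ℂ] EuclideanSpace ℂ (Fin d),
      σ.map (sphereMap d U) = σ

/-- The two-way collision probability `p_ψ = Σ_x |ψ_x|⁴`. -/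
def pColl (d : ℕ) (ψ : unitSphere d) : ℝ :=
  ∑ x : Fin d, ‖(ψ : EuclideanSpace ℂ (Fin d)) x‖ ^ 4

/-- The three-way collision probability `q_ψ = Σ_x |ψ_x|⁶`. -/
def qColl (d : ℕ) (ψ : unitSphere d) : ℝ :=
  ∑ x : Fin d, ‖(ψ : EuclideanSpace ℂ (Fin d)) x‖ ^ 6

open scoped Classical

/-- The Born measure on `{1,…,d}` of a state `ψ`: it assigns mass `|ψ_x|²` to `x`. -/
def bornMeasure (d : ℕ) (ψ : unitSphere d) : Measure (Fin d) :=
  Measure.sum fun x : Fin d =>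
    (ENNReal.ofReal (‖(ψ : EuclideanSpace ℂ (Fin d)) x‖ ^ 2)) • Measure.dirac x

/-- The number of colliding pairs `M^(r)` within block `r` of the samples `ω`. -/
def blockCollisions {X : Type*} (k t : ℕ) (r : Fin k) (ω : Fin k × Fin t → X) : ℝ :=
  ((Finset.univ.filter fun ij : Fin t × Fin t =>
      ij.1 < ij.2 ∧ ω (r, ij.1) = ω (r, ij.2)).card : ℝ)

/-- The block average `M = (1/k)·Σ_r M^(r)`. -/
def blockAvg {X : Type*} (k t : ℕ) (ω : Fin k × Fin t → X) : ℝ :=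
  (k : ℝ)⁻¹ * ∑ r : Fin k, blockCollisions k t r ω

section Sampling

variable {ι X : Type*}

/-- The event that the samples indexed by `S` all agree. -/
def agreeOn (S : Finset ι) : Set (ι → X) := {ω | ∃ x, ∀ a ∈ S, ω a = x}

/-- The collision indicator of a pair of samples. -/
def collide (e : ι × ι) (ω : ι → X) : ℝ := if ω e.1 = ω e.2 then 1 else 0

lemma collide_eq_indicator (e : ι × ι) :
    (collide e : (ι → X) → ℝ) = (agreeOn {e.1, e.2}).indicator 1 := by
  ext ω
  simp only [collide, Set.indicator_apply, agreeOn, Set.mem_ofPred_eq, Finset.mem_insert,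
    Finset.mem_singleton, forall_eq_or_imp, forall_eq, Pi.one_apply]
  exact if_congr ⟨fun h => ⟨_, h, rfl⟩, fun ⟨x, h, h'⟩ => h.trans h'.symm⟩ rfl rfl

lemma collide_mul_collide {e f : ι × ι}
    (hef : e.1 = f.1 ∨ e.1 = f.2 ∨ e.2 = f.1 ∨ e.2 = f.2) :
    (fun ω : ι → X => collide e ω * collide f ω) =
      (agreeOn ({e.1, e.2} ∪ {f.1, f.2})).indicator 1 := by
  ext ω
  simp only [collide, Set.indicator_apply, agreeOn, Set.mem_ofPred_eq, Finset.mem_insert,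
    Finset.mem_singleton, Finset.mem_union, Pi.one_apply, ← ite_and, ite_mul, one_mul, zero_mul]
  refine if_congr ⟨fun ⟨h, h'⟩ => ⟨ω e.1, ?_⟩, fun ⟨x, h⟩ => ?_⟩ rfl rfl
  · rintro a ((rfl | rfl) | (rfl | rfl)) <;> rcases hef with hh | hh | hh | hh <;> simp_all
  · exact ⟨(h _ (by simp)).trans (h _ (by simp)).symm, (h _ (by simp)).trans (h _ (by simp)).symm⟩

lemma sum_measureReal_singleton_pow_anti {X : Type*} [Fintype X] [MeasurableSpace X]
    (μ : Measure X) [IsProbabilityMeasure μ] {n m : ℕ} (h : n ≤ m) :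
    ∑ x, μ.real {x} ^ m ≤ ∑ x, μ.real {x} ^ n :=
  Finset.sum_le_sum fun _ _ => pow_le_pow_of_le_one measureReal_nonneg measureReal_le_one h

variable [Fintype ι] [Fintype X] [MeasurableSpace X] [MeasurableSingletonClass X]

lemma measurableSet_agreeOn (S : Finset ι) : MeasurableSet (agreeOn S : Set (ι → X)) :=
  (Set.toFinite _).measurableSet

lemma measureReal_agreeOn (μ : Measure X) [IsProbabilityMeasure μ] {S : Finset ι}
    (hS : S.Nonempty) :
    (Measure.pi fun _ : ι => μ).real (agreeOn S) = ∑ x, μ.real {x} ^ S.card := by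
  have hU : (agreeOn S : Set (ι → X)) = ⋃ x ∈ (Finset.univ : Finset X),
      Set.pi Set.univ fun a => if a ∈ S then {x} else Set.univ := by
    ext ω
    simp only [agreeOn, Set.mem_ofPred_eq, Set.mem_iUnion, Set.mem_pi, Set.mem_univ, true_implies,
      Finset.mem_univ, exists_const]
    refine exists_congr fun x => forall_congr' fun a => ?_
    by_cases ha : a ∈ S <;> simp [ha]
  rw [hU, measureReal_biUnion_finset]
  · refine Finset.sum_congr rfl fun x _ => ?_
    rw [measureReal_def, Measure.pi_pi]
    have : ∀ a, μ (if a ∈ S then {x} else Set.univ) = if a ∈ S then μ {x} else 1 := by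
      intro a; by_cases ha : a ∈ S <;> simp [ha]
    simp [this, measureReal_def, ENNReal.toReal_pow]
  · intro x _ y _ hxy
    refine Set.disjoint_left.2 fun ω hx hy => hxy ?_
    obtain ⟨a, ha⟩ := hS
    have h₁ := hx a trivial
    have h₂ := hy a trivial
    simp only [ha, if_true, Set.mem_singleton_iff] at h₁ h₂
    exact h₁.symm.trans h₂
  · exact fun x _ => (Set.toFinite _).measurableSet

lemma integral_collide (μ : Measure X) [IsProbabilityMeasure μ] {e : ι × ι} (he : e.1 ≠ e.2) :
    ∫ ω, collide e ω ∂(Measure.pi fun _ : ι => μ) = ∑ x, μ.real {x} ^ 2 := by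
  rw [collide_eq_indicator, integral_indicator_one (measurableSet_agreeOn _),
    measureReal_agreeOn _ (by simp), Finset.card_pair he]

lemma integral_centered_mul (μ : Measure X) [IsProbabilityMeasure μ] {e f : ι × ι}
    (he : e.1 ≠ e.2) (hf : f.1 ≠ f.2) :
    ∫ ω, (collide e ω - ∑ x, μ.real {x} ^ 2) * (collide f ω - ∑ x, μ.real {x} ^ 2)
        ∂(Measure.pi fun _ : ι => μ) =
      ∫ ω, collide e ω * collide f ω ∂(Measure.pi fun _ : ι => μ) -
        (∑ x, μ.real {x} ^ 2) ^ 2 := by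
  set p := ∑ x, μ.real {x} ^ 2
  have : ∀ ω : ι → X, (collide e ω - p) * (collide f ω - p) =
      collide e ω * collide f ω - p * collide e ω - p * collide f ω + p ^ 2 := fun ω => by ring
  simp_rw [this]
  rw [integral_add .of_finite .of_finite, integral_sub .of_finite .of_finite,
    integral_sub .of_finite .of_finite, integral_const_mul, integral_const_mul,
    integral_collide μ he, integral_collide μ hf]
  simp
  ring

/-- Covariance bound for two collision indicators. -/
lemma integral_centered_mul_le (μ : Measure X) [IsProbabilityMeasure μ] {e f : ι × ι}
    (he : e.1 ≠ e.2) (hf : f.1 ≠ f.2) (hsw : ¬ (e.1 = f.2 ∧ e.2 = f.1)) :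
    ∫ ω, (collide e ω - ∑ x, μ.real {x} ^ 2) * (collide f ω - ∑ x, μ.real {x} ^ 2)
        ∂(Measure.pi fun _ : ι => μ) ≤
      (if f = e then ∑ x, μ.real {x} ^ 2 else 0) +
      (if e.1 = f.1 ∨ e.1 = f.2 ∨ e.2 = f.1 ∨ e.2 = f.2 then ∑ x, μ.real {x} ^ 3 else 0) := by
  rw [integral_centered_mul μ he hf]
  have hq : 0 ≤ ∑ x, μ.real {x} ^ 3 := Finset.sum_nonneg fun _ _ => by positivity
  by_cases hef : e.1 = f.1 ∨ e.1 = f.2 ∨ e.2 = f.1 ∨ e.2 = f.2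
  · rw [if_pos hef, collide_mul_collide hef, integral_indicator_one (measurableSet_agreeOn _),
      measureReal_agreeOn _ (by simp)]
    have h2 := sq_nonneg (∑ x, μ.real {x} ^ 2)
    by_cases h : f = e
    · subst h
      rw [if_pos rfl, Finset.union_self, Finset.card_pair he]
      linarith
    · rw [if_neg h]
      have hc : 3 ≤ (({e.1, e.2} : Finset ι) ∪ {f.1, f.2}).card := by
        by_contra! hlt
        have hE : ({e.1, e.2} : Finset ι) = {e.1, e.2} ∪ {f.1, f.2} :=
          Finset.eq_of_subset_of_card_le Finset.subset_union_left
            (by rw [Finset.card_pair he]; omega)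
        have h1 : f.1 ∈ ({e.1, e.2} : Finset ι) := by rw [hE]; simp
        have h2 : f.2 ∈ ({e.1, e.2} : Finset ι) := by rw [hE]; simp
        simp only [Finset.mem_insert, Finset.mem_singleton] at h1 h2
        rcases h1 with h1 | h1 <;> rcases h2 with h2 | h2
        · exact hf (h1.trans h2.symm)
        · exact h (Prod.ext h1 h2)
        · exact hsw ⟨h2.symm, h1.symm⟩
        · exact hf (h1.trans h2.symm)
      have := sum_measureReal_singleton_pow_anti μ hc
      linarith
  · have hne : f ≠ e := by rintro rfl; exact hef (Or.inl rfl)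
    rw [if_neg hef, if_neg hne]
    push Not at hef
    obtain ⟨h1, h2, h3, h4⟩ := hef
    have hind : ProbabilityTheory.iIndepFun (fun (i : ι) (ω : ι → X) => ω i)
        (Measure.pi fun _ : ι => μ) :=
      ProbabilityTheory.iIndepFun_pi (X := fun _ x => x) fun _ => aemeasurable_id
    have h := hind.indepFun_prodMk_prodMk (fun i => measurable_pi_apply i) e.1 e.2 f.1 f.2
      h1 h2 h3 h4
    have h' := h.comp (φ := fun z : X × X => if z.1 = z.2 then (1 : ℝ) else 0)
      (ψ := fun z : X × X => if z.1 = z.2 then (1 : ℝ) else 0)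
      (measurable_of_finite _) (measurable_of_finite _)
    have h'' := h'.integral_fun_mul_eq_mul_integral
      (measurable_of_finite _).aestronglyMeasurable (measurable_of_finite _).aestronglyMeasurable
    have e1 := integral_collide μ he
    have e2 := integral_collide μ hf
    simp only [collide, Function.comp_def] at h'' e1 e2 ⊢
    rw [h'', e1, e2]
    simp [sq]

end Sampling

section Moments

variable {d : ℕ}

/-- Replace the coordinates `x`, `y` of a vector by a linear combination of them. -/
def planeMap (x y : Fin d) (α β γ δ : ℂ) :
    EuclideanSpace ℂ (Fin d) →ₗ[ℂ] EuclideanSpace ℂ (Fin d) where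
  toFun v := WithLp.toLp 2 fun z =>
    if z = x then α * v x + β * v y else if z = y then γ * v x + δ * v y else v z
  map_add' v w := by
    ext z
    simp only [PiLp.add_apply]
    split_ifs <;> ring
  map_smul' c v := by
    ext z
    simp only [PiLp.smul_apply, smul_eq_mul, RingHom.id_apply]
    split_ifs <;> ring

lemma planeMap_apply (x y : Fin d) (α β γ δ : ℂ) (v : EuclideanSpace ℂ (Fin d)) (z : Fin d) :
    planeMap x y α β γ δ v z =
      if z = x then α * v x + β * v y else if z = y then γ * v x + δ * v y else v z := rfl

lemma sum_eq_add_add_sum_compl {x y : Fin d} (hxy : x ≠ y) (f : Fin d → ℝ) :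
    ∑ z, f z = f x + f y + ∑ z ∈ ({x, y} : Finset (Fin d))ᶜ, f z := by
  rw [← Finset.sum_add_sum_compl {x, y} f, Finset.sum_pair hxy]

lemma norm_planeMap {x y : Fin d} (hxy : x ≠ y) {α β γ δ : ℂ}
    (h : ∀ u v : ℂ, ‖α * u + β * v‖ ^ 2 + ‖γ * u + δ * v‖ ^ 2 = ‖u‖ ^ 2 + ‖v‖ ^ 2)
    (v : EuclideanSpace ℂ (Fin d)) : ‖planeMap x y α β γ δ v‖ = ‖v‖ := by
  rw [← sq_eq_sq₀ (norm_nonneg _) (norm_nonneg _), EuclideanSpace.norm_sq_eq,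
    EuclideanSpace.norm_sq_eq, sum_eq_add_add_sum_compl hxy, sum_eq_add_add_sum_compl hxy,
    ← h (v x) (v y)]
  congr 1
  · simp [planeMap_apply, hxy.symm]
  · refine Finset.sum_congr rfl fun z hz => ?_
    simp only [Finset.mem_compl, Finset.mem_insert, Finset.mem_singleton, not_or] at hz
    simp [planeMap_apply, hz.1, hz.2]

/-- A unitary acting in the plane of two coordinates. -/
def planeIsometry {x y : Fin d} (hxy : x ≠ y) {α β γ δ : ℂ}
    (h : ∀ u v : ℂ, ‖α * u + β * v‖ ^ 2 + ‖γ * u + δ * v‖ ^ 2 = ‖u‖ ^ 2 + ‖v‖ ^ 2) :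
    EuclideanSpace ℂ (Fin d) ≃ₗᵢ[ℂ] EuclideanSpace ℂ (Fin d) :=
  LinearIsometry.toLinearIsometryEquiv ⟨planeMap x y α β γ δ, norm_planeMap hxy h⟩ rfl

lemma sphereMap_planeIsometry {x y : Fin d} (hxy : x ≠ y) {α β γ δ : ℂ}
    (h : ∀ u v : ℂ, ‖α * u + β * v‖ ^ 2 + ‖γ * u + δ * v‖ ^ 2 = ‖u‖ ^ 2 + ‖v‖ ^ 2)
    (ψ : unitSphere d) (z : Fin d) :
    (sphereMap d (planeIsometry hxy h) ψ).1 z =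
      if z = x then α * ψ.1 x + β * ψ.1 y else if z = y then γ * ψ.1 x + δ * ψ.1 y
        else ψ.1 z := rfl

lemma continuous_sphereMap
    (U : EuclideanSpace ℂ (Fin d) ≃ₗᵢ[ℂ] EuclideanSpace ℂ (Fin d)) :
    Continuous (sphereMap d U) :=
  (U.continuous.comp continuous_subtype_val).subtype_mk _

lemma continuous_coord (x : Fin d) : Continuous fun ψ : unitSphere d => ψ.1 x := by
  fun_prop

lemma Continuous.integrable_unitSphere {σ : Measure (unitSphere d)} [IsFiniteMeasure σ]
    {F : unitSphere d → ℝ} (hF : Continuous F) : Integrable F σ :=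
  hF.integrable_of_hasCompactSupport (HasCompactSupport.of_compactSpace F)

lemma IsUniformSphereMeasure.integral_comp {σ : Measure (unitSphere d)}
    (hσ : IsUniformSphereMeasure d σ)
    (U : EuclideanSpace ℂ (Fin d) ≃ₗᵢ[ℂ] EuclideanSpace ℂ (Fin d))
    {F : unitSphere d → ℝ} (hF : Continuous F) :
    ∫ ψ, F (sphereMap d U ψ) ∂σ = ∫ ψ, F ψ ∂σ := by
  conv_rhs => rw [← hσ.2 U]
  exact (integral_map (continuous_sphereMap U).aemeasurable hF.aestronglyMeasurable).symm

/-- The Born weight `|ψ_x|²`. -/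
def weight (x : Fin d) (ψ : unitSphere d) : ℝ := ‖ψ.1 x‖ ^ 2

lemma weight_nonneg (x : Fin d) (ψ : unitSphere d) : 0 ≤ weight x ψ := sq_nonneg _

/-- The power sum `Σ_x |ψ_x|^{2n}`. -/
def powerSum (n : ℕ) (ψ : unitSphere d) : ℝ := ∑ x, weight x ψ ^ n

@[fun_prop]
lemma continuous_weight (x : Fin d) : Continuous (weight x : unitSphere d → ℝ) :=
  (continuous_coord x).norm.pow 2

@[fun_prop]
lemma continuous_powerSum (n : ℕ) : Continuous (powerSum n : unitSphere d → ℝ) := by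
  unfold powerSum
  fun_prop

lemma sum_weight (ψ : unitSphere d) : ∑ x, weight x ψ = 1 := by
  have h : ‖ψ.1‖ = 1 := by simp
  have := EuclideanSpace.norm_sq_eq ψ.1
  rw [h] at this
  simpa [weight] using this.symm

/-- Conditionally on the other coordinates, `|ψ_x|²` and `|ψ_y|²` satisfy the second moment
relation of a uniform point of a segment. -/
lemma IsUniformSphereMeasure.pair_relation {σ : Measure (unitSphere d)}
    (hσ : IsUniformSphereMeasure d σ) {x y : Fin d} (hxy : x ≠ y) {h : unitSphere d → ℝ}
    (hc : Continuous h)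
    (hinv : ∀ ψ φ : unitSphere d, (∀ z, z ≠ x → z ≠ y → ψ.1 z = φ.1 z) → h ψ = h φ) :
    ∫ ψ, (weight x ψ ^ 2 + weight y ψ ^ 2 - 4 * (weight x ψ * weight y ψ)) * h ψ ∂σ = 0 := by
  have := hσ.1
  set Z : unitSphere d → ℝ := fun ψ => (ψ.1 x * star (ψ.1 y)).re with hZ
  set W : unitSphere d → ℝ := fun ψ => (ψ.1 x * star (ψ.1 y)).im with hW
  have cx := continuous_coord (d := d) x
  have cy := continuous_coord (d := d) y
  have cZ : Continuous Z := Complex.continuous_re.comp (cx.mul cy.star)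
  have cW : Continuous W := Complex.continuous_im.comp (cx.mul cy.star)
  have hZW : ∀ ψ, Z ψ ^ 2 + W ψ ^ 2 = weight x ψ * weight y ψ := fun ψ => by
    simp only [hZ, hW, weight, Complex.sq_norm, Complex.normSq_apply, Complex.mul_re,
      Complex.mul_im, Complex.star_def, Complex.conj_re, Complex.conj_im]
    ring
  have hP : ∀ u v : ℂ, ‖(1 : ℂ) * u + 0 * v‖ ^ 2 + ‖(0 : ℂ) * u + Complex.I * v‖ ^ 2
      = ‖u‖ ^ 2 + ‖v‖ ^ 2 := fun u v => by simp
  set s : ℝ := √2 / 2 with hs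
  have hs2 : s ^ 2 = 1 / 2 := by rw [hs, div_pow, Real.sq_sqrt (by norm_num)]; norm_num
  have hH : ∀ u v : ℂ, ‖(s : ℂ) * u + s * v‖ ^ 2 + ‖(s : ℂ) * u + (-s : ℂ) * v‖ ^ 2
      = ‖u‖ ^ 2 + ‖v‖ ^ 2 := fun u v => by
    simp only [Complex.sq_norm, Complex.normSq_apply, Complex.add_re, Complex.add_im,
      Complex.mul_re, Complex.mul_im, Complex.neg_re, Complex.neg_im, Complex.ofReal_re,
      Complex.ofReal_im]
    linear_combination (2 * (u.re ^ 2 + u.im ^ 2 + v.re ^ 2 + v.im ^ 2)) * hs2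
  have inv : ∀ {α β γ δ : ℂ} (hU : ∀ u v : ℂ, ‖α * u + β * v‖ ^ 2 + ‖γ * u + δ * v‖ ^ 2
      = ‖u‖ ^ 2 + ‖v‖ ^ 2) (ψ : unitSphere d),
      h (sphereMap d (planeIsometry hxy hU) ψ) = h ψ := fun hU ψ =>
    hinv _ _ fun z hzx hzy => by simp [sphereMap_planeIsometry, hzx, hzy]
  have e1 : ∫ ψ, Z ψ ^ 2 * h ψ ∂σ = ∫ ψ, W ψ ^ 2 * h ψ ∂σ := by
    rw [← hσ.integral_comp (F := fun ψ => Z ψ ^ 2 * h ψ) (planeIsometry hxy hP) (by fun_prop)]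
    refine integral_congr_ae (.of_forall fun ψ => ?_)
    simp [inv, hZ, hW, sphereMap_planeIsometry, hxy.symm]
  have e2 : ∫ ψ, Z ψ ^ 2 * h ψ ∂σ + ∫ ψ, W ψ ^ 2 * h ψ ∂σ =
      ∫ ψ, weight x ψ * weight y ψ * h ψ ∂σ := by
    rw [← integral_add (Continuous.integrable_unitSphere (by fun_prop))
      (Continuous.integrable_unitSphere (by fun_prop))]
    exact integral_congr_ae (.of_forall fun ψ => by simp only [← hZW]; ring)
  have e3 : ∫ ψ, (weight x ψ ^ 2 + weight y ψ ^ 2) * h ψ ∂σ =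
      ∫ ψ, ((weight x ψ ^ 2 + weight y ψ ^ 2) * h ψ / 2 + weight x ψ * weight y ψ * h ψ +
        2 * (Z ψ ^ 2 * h ψ)) ∂σ := by
    rw [← hσ.integral_comp (planeIsometry hxy hH) (by fun_prop)]
    refine integral_congr_ae (.of_forall fun ψ => ?_)
    simp only [inv]
    have hx : weight x (sphereMap d (planeIsometry hxy hH) ψ) =
        (weight x ψ + weight y ψ) / 2 + Z ψ := by
      simp only [weight, sphereMap_planeIsometry, if_true, hZ, Complex.sq_norm,
        Complex.normSq_apply, Complex.add_re, Complex.add_im, Complex.mul_re, Complex.mul_im,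
        Complex.ofReal_re, Complex.ofReal_im, Complex.star_def, Complex.conj_re, Complex.conj_im]
      linear_combination (((ψ.1 x).re + (ψ.1 y).re) ^ 2 + ((ψ.1 x).im + (ψ.1 y).im) ^ 2) * hs2
    have hy : weight y (sphereMap d (planeIsometry hxy hH) ψ) =
        (weight x ψ + weight y ψ) / 2 - Z ψ := by
      simp only [weight, sphereMap_planeIsometry, if_true, if_neg hxy.symm, hZ, Complex.sq_norm,
        Complex.normSq_apply, Complex.add_re, Complex.add_im, Complex.mul_re, Complex.mul_im,
        Complex.neg_re, Complex.neg_im,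
        Complex.ofReal_re, Complex.ofReal_im, Complex.star_def, Complex.conj_re, Complex.conj_im]
      linear_combination (((ψ.1 x).re - (ψ.1 y).re) ^ 2 + ((ψ.1 x).im - (ψ.1 y).im) ^ 2) * hs2
    rw [hx, hy]
    ring
  rw [integral_add (Continuous.integrable_unitSphere (by fun_prop))
      (Continuous.integrable_unitSphere (by fun_prop)),
    integral_add (Continuous.integrable_unitSphere (by fun_prop))
      (Continuous.integrable_unitSphere (by fun_prop)), integral_div, integral_const_mul] at e3
  simp only [sub_mul, mul_assoc (4 : ℝ)]
  rw [integral_sub (Continuous.integrable_unitSphere (by fun_prop))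
      (Continuous.integrable_unitSphere (by fun_prop)), integral_const_mul]
  linarith

lemma integral_sum_pairs {σ : Measure (unitSphere d)} [IsFiniteMeasure σ]
    {G : Fin d → Fin d → unitSphere d → ℝ} (hG : ∀ x y, Continuous (G x y))
    (h0 : ∀ x y, x ≠ y → ∫ ψ, G x y ψ ∂σ = 0) :
    ∫ ψ, ∑ x, ∑ y, G x y ψ ∂σ = ∫ ψ, ∑ x, G x x ψ ∂σ := by
  rw [integral_finsetSum _ fun x _ => Continuous.integrable_unitSphere (by fun_prop),
    integral_finsetSum _ fun x _ => Continuous.integrable_unitSphere (by fun_prop)]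
  refine Finset.sum_congr rfl fun x _ => ?_
  rw [integral_finsetSum _ fun y _ => Continuous.integrable_unitSphere (by fun_prop)]
  exact Finset.sum_eq_single x (fun y _ hy => h0 x y hy.symm) (by simp)

lemma sum_sum_weight_mul (m n : ℕ) (ψ : unitSphere d) :
    ∑ x, ∑ y, weight x ψ ^ m * weight y ψ ^ n = powerSum m ψ * powerSum n ψ := by
  simp only [powerSum, Finset.sum_mul_sum]

lemma sum_sum_const_mul_weight_mul (c : ℝ) (m n : ℕ) (ψ : unitSphere d) :
    ∑ x, ∑ y, c * (weight x ψ ^ m * weight y ψ ^ n) = c * (powerSum m ψ * powerSum n ψ) := by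
  rw [← sum_sum_weight_mul, Finset.mul_sum]
  exact Finset.sum_congr rfl fun x _ => (Finset.mul_sum _ _ _).symm

lemma powerSum_zero (ψ : unitSphere d) : powerSum 0 ψ = d := by simp [powerSum]

lemma powerSum_one (ψ : unitSphere d) : powerSum 1 ψ = 1 := by simp [powerSum, sum_weight]

/-- The pair relation weighted by a power of `|ψ_x|² + |ψ_y|²`. -/
lemma IsUniformSphereMeasure.pair_relation_pow {σ : Measure (unitSphere d)}
    (hσ : IsUniformSphereMeasure d σ) {x y : Fin d} (hxy : x ≠ y) (n : ℕ) :
    ∫ ψ, (weight x ψ ^ 2 + weight y ψ ^ 2 - 4 * (weight x ψ * weight y ψ)) *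
      (weight x ψ + weight y ψ) ^ n ∂σ = 0 := by
  refine hσ.pair_relation hxy (by fun_prop) fun ψ φ h => ?_
  have key : ∀ ψ : unitSphere d, weight x ψ + weight y ψ =
      1 - ∑ z ∈ ({x, y} : Finset (Fin d))ᶜ, weight z ψ := fun ψ => by
    rw [← sum_weight ψ, sum_eq_add_add_sum_compl hxy]; ring
  rw [key, key]
  congr 2
  refine Finset.sum_congr rfl fun z hz => ?_
  simp only [Finset.mem_compl, Finset.mem_insert, Finset.mem_singleton, not_or] at hz
  simp only [weight, h z hz.1 hz.2]

lemma IsUniformSphereMeasure.pair_relation_powerSum {σ : Measure (unitSphere d)}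
    (hσ : IsUniformSphereMeasure d σ) {x y : Fin d} (hxy : x ≠ y) :
    ∫ ψ, (weight x ψ ^ 2 + weight y ψ ^ 2 - 4 * (weight x ψ * weight y ψ)) *
      (powerSum 2 ψ - weight x ψ ^ 2 - weight y ψ ^ 2) ∂σ = 0 := by
  refine hσ.pair_relation hxy (by fun_prop) fun ψ φ h => ?_
  have key : ∀ ψ : unitSphere d, powerSum 2 ψ - weight x ψ ^ 2 - weight y ψ ^ 2 =
      ∑ z ∈ ({x, y} : Finset (Fin d))ᶜ, weight z ψ ^ 2 := fun ψ => by
    rw [powerSum, sum_eq_add_add_sum_compl hxy]; ring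
  rw [key, key]
  refine Finset.sum_congr rfl fun z hz => ?_
  simp only [Finset.mem_compl, Finset.mem_insert, Finset.mem_singleton, not_or] at hz
  simp only [weight, h z hz.1 hz.2]

lemma IsUniformSphereMeasure.integral_powerSum_two {σ : Measure (unitSphere d)}
    (hσ : IsUniformSphereMeasure d σ) : ∫ ψ, powerSum 2 ψ ∂σ = 2 / ((d : ℝ) + 1) := by
  have := hσ.1
  have h := integral_sum_pairs (σ := σ) (fun _ _ => by fun_prop)
    fun x y hxy => hσ.pair_relation_pow hxy 0
  have hl : ∀ ψ : unitSphere d, ∑ x, ∑ y, (weight x ψ ^ 2 + weight y ψ ^ 2 -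
      4 * (weight x ψ * weight y ψ)) * (weight x ψ + weight y ψ) ^ 0 =
      2 * d * powerSum 2 ψ - 4 := fun ψ => by
    have e : ∀ x y, (weight x ψ ^ 2 + weight y ψ ^ 2 -
        4 * (weight x ψ * weight y ψ)) * (weight x ψ + weight y ψ) ^ 0 =
        weight x ψ ^ 2 * weight y ψ ^ 0 + weight x ψ ^ 0 * weight y ψ ^ 2 -
        4 * (weight x ψ ^ 1 * weight y ψ ^ 1) := fun x y => by ring
    simp only [e, Finset.sum_add_distrib, Finset.sum_sub_distrib,
      sum_sum_weight_mul, sum_sum_const_mul_weight_mul, powerSum_zero, powerSum_one]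
    ring
  have hr : ∀ ψ : unitSphere d, ∑ x, (weight x ψ ^ 2 + weight x ψ ^ 2 -
      4 * (weight x ψ * weight x ψ)) * (weight x ψ + weight x ψ) ^ 0 =
      -2 * powerSum 2 ψ := fun ψ => by
    rw [powerSum, Finset.mul_sum]
    exact Finset.sum_congr rfl fun x _ => by ring
  simp only [hl, hr] at h
  rw [integral_sub (Continuous.integrable_unitSphere (by fun_prop)) (integrable_const _),
    integral_const_mul, integral_const_mul] at h
  simp only [integral_const, probReal_univ, smul_eq_mul, one_mul] at h
  rw [eq_div_iff (by positivity)]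
  linarith

lemma IsUniformSphereMeasure.integral_powerSum_three {σ : Measure (unitSphere d)}
    (hσ : IsUniformSphereMeasure d σ) :
    ∫ ψ, powerSum 3 ψ ∂σ = 6 / (((d : ℝ) + 1) * (d + 2)) := by
  have := hσ.1
  have h := integral_sum_pairs (σ := σ) (fun _ _ => by fun_prop)
    fun x y hxy => hσ.pair_relation_pow hxy 1
  have hl : ∀ ψ : unitSphere d, ∑ x, ∑ y, (weight x ψ ^ 2 + weight y ψ ^ 2 -
      4 * (weight x ψ * weight y ψ)) * (weight x ψ + weight y ψ) ^ 1 =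
      2 * d * powerSum 3 ψ - 6 * powerSum 2 ψ := fun ψ => by
    have e : ∀ x y, (weight x ψ ^ 2 + weight y ψ ^ 2 -
        4 * (weight x ψ * weight y ψ)) * (weight x ψ + weight y ψ) ^ 1 =
        weight x ψ ^ 3 * weight y ψ ^ 0 + weight x ψ ^ 0 * weight y ψ ^ 3 -
        3 * (weight x ψ ^ 2 * weight y ψ ^ 1) - 3 * (weight x ψ ^ 1 * weight y ψ ^ 2) :=
      fun x y => by ring
    simp only [e, Finset.sum_add_distrib, Finset.sum_sub_distrib,
      sum_sum_weight_mul, sum_sum_const_mul_weight_mul, powerSum_zero, powerSum_one]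
    ring
  have hr : ∀ ψ : unitSphere d, ∑ x, (weight x ψ ^ 2 + weight x ψ ^ 2 -
      4 * (weight x ψ * weight x ψ)) * (weight x ψ + weight x ψ) ^ 1 =
      -4 * powerSum 3 ψ := fun ψ => by
    rw [powerSum, Finset.mul_sum]
    exact Finset.sum_congr rfl fun x _ => by ring
  simp only [hl, hr] at h
  rw [integral_sub (Continuous.integrable_unitSphere (by fun_prop))
    (Continuous.integrable_unitSphere (by fun_prop)),
    integral_const_mul, integral_const_mul, integral_const_mul, hσ.integral_powerSum_two] at h
  rw [eq_div_iff (by positivity)]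
  field_simp at h
  linarith

lemma IsUniformSphereMeasure.integral_powerSum_four {σ : Measure (unitSphere d)}
    (hσ : IsUniformSphereMeasure d σ) :
    ((d : ℝ) + 4) * ∫ ψ, powerSum 4 ψ ∂σ =
      2 * ∫ ψ, powerSum 3 ψ ∂σ + 3 * ∫ ψ, powerSum 2 ψ ^ 2 ∂σ := by
  have := hσ.1
  have h := integral_sum_pairs (σ := σ) (fun _ _ => by fun_prop)
    fun x y hxy => hσ.pair_relation_pow hxy 2
  have hl : ∀ ψ : unitSphere d, ∑ x, ∑ y, (weight x ψ ^ 2 + weight y ψ ^ 2 -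
      4 * (weight x ψ * weight y ψ)) * (weight x ψ + weight y ψ) ^ 2 =
      2 * d * powerSum 4 ψ - 4 * powerSum 3 ψ - 6 * powerSum 2 ψ ^ 2 := fun ψ => by
    have e : ∀ x y, (weight x ψ ^ 2 + weight y ψ ^ 2 -
        4 * (weight x ψ * weight y ψ)) * (weight x ψ + weight y ψ) ^ 2 =
        weight x ψ ^ 4 * weight y ψ ^ 0 + weight x ψ ^ 0 * weight y ψ ^ 4 -
        2 * (weight x ψ ^ 3 * weight y ψ ^ 1) - 2 * (weight x ψ ^ 1 * weight y ψ ^ 3) -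
        6 * (weight x ψ ^ 2 * weight y ψ ^ 2) :=
      fun x y => by ring
    simp only [e, Finset.sum_add_distrib, Finset.sum_sub_distrib,
      sum_sum_weight_mul, sum_sum_const_mul_weight_mul, powerSum_zero, powerSum_one]
    ring
  have hr : ∀ ψ : unitSphere d, ∑ x, (weight x ψ ^ 2 + weight x ψ ^ 2 -
      4 * (weight x ψ * weight x ψ)) * (weight x ψ + weight x ψ) ^ 2 =
      -8 * powerSum 4 ψ := fun ψ => by
    rw [powerSum, Finset.mul_sum]
    exact Finset.sum_congr rfl fun x _ => by ring
  simp only [hl, hr] at h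
  rw [integral_sub (Continuous.integrable_unitSphere (by fun_prop))
    (Continuous.integrable_unitSphere (by fun_prop)),
    integral_sub (Continuous.integrable_unitSphere (by fun_prop))
    (Continuous.integrable_unitSphere (by fun_prop)),
    integral_const_mul, integral_const_mul, integral_const_mul, integral_const_mul] at h
  linarith

lemma IsUniformSphereMeasure.integral_powerSum_two_sq_relation {σ : Measure (unitSphere d)}
    (hσ : IsUniformSphereMeasure d σ) :
    (d : ℝ) * ∫ ψ, powerSum 2 ψ ^ 2 ∂σ =
      2 * ∫ ψ, powerSum 2 ψ ∂σ - 4 * ∫ ψ, powerSum 3 ψ ∂σ +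
        (d + 2) * ∫ ψ, powerSum 4 ψ ∂σ := by
  have := hσ.1
  have h := integral_sum_pairs (σ := σ) (fun _ _ => by fun_prop)
    fun x y hxy => hσ.pair_relation_powerSum hxy
  have hl : ∀ ψ : unitSphere d, ∑ x, ∑ y, (weight x ψ ^ 2 + weight y ψ ^ 2 -
      4 * (weight x ψ * weight y ψ)) * (powerSum 2 ψ - weight x ψ ^ 2 - weight y ψ ^ 2) =
      (2 * d - 2) * powerSum 2 ψ ^ 2 - 4 * powerSum 2 ψ - 2 * d * powerSum 4 ψ +
        8 * powerSum 3 ψ := fun ψ => by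
    have e : ∀ x y, (weight x ψ ^ 2 + weight y ψ ^ 2 -
        4 * (weight x ψ * weight y ψ)) * (powerSum 2 ψ - weight x ψ ^ 2 - weight y ψ ^ 2) =
        powerSum 2 ψ * (weight x ψ ^ 2 * weight y ψ ^ 0) +
        powerSum 2 ψ * (weight x ψ ^ 0 * weight y ψ ^ 2) -
        (4 * powerSum 2 ψ) * (weight x ψ ^ 1 * weight y ψ ^ 1) -
        weight x ψ ^ 4 * weight y ψ ^ 0 - weight x ψ ^ 0 * weight y ψ ^ 4 -
        2 * (weight x ψ ^ 2 * weight y ψ ^ 2) +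
        4 * (weight x ψ ^ 3 * weight y ψ ^ 1) + 4 * (weight x ψ ^ 1 * weight y ψ ^ 3) :=
      fun x y => by ring
    simp only [e, Finset.sum_add_distrib, Finset.sum_sub_distrib,
      sum_sum_weight_mul, sum_sum_const_mul_weight_mul, powerSum_zero, powerSum_one]
    ring
  have hr : ∀ ψ : unitSphere d, ∑ x, (weight x ψ ^ 2 + weight x ψ ^ 2 -
      4 * (weight x ψ * weight x ψ)) * (powerSum 2 ψ - weight x ψ ^ 2 - weight x ψ ^ 2) =
      4 * powerSum 4 ψ - 2 * powerSum 2 ψ ^ 2 := fun ψ => by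
    have e : ∀ x, (weight x ψ ^ 2 + weight x ψ ^ 2 -
      4 * (weight x ψ * weight x ψ)) * (powerSum 2 ψ - weight x ψ ^ 2 - weight x ψ ^ 2) =
      4 * weight x ψ ^ 4 - (2 * powerSum 2 ψ) * weight x ψ ^ 2 := fun x => by ring
    simp only [e, Finset.sum_sub_distrib, ← Finset.mul_sum]
    simp only [powerSum]
    ring
  simp only [hl, hr] at h
  rw [integral_add (Continuous.integrable_unitSphere (by fun_prop))
    (Continuous.integrable_unitSphere (by fun_prop)),
    integral_sub (Continuous.integrable_unitSphere (by fun_prop))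
    (Continuous.integrable_unitSphere (by fun_prop)),
    integral_sub (Continuous.integrable_unitSphere (by fun_prop))
    (Continuous.integrable_unitSphere (by fun_prop)),
    integral_sub (Continuous.integrable_unitSphere (by fun_prop))
    (Continuous.integrable_unitSphere (by fun_prop))] at h
  simp only [integral_const_mul] at h
  linarith

lemma IsUniformSphereMeasure.integral_powerSum_two_sq {σ : Measure (unitSphere d)}
    (hσ : IsUniformSphereMeasure d σ) (hd : 3 ≤ d) :
    ∫ ψ, powerSum 2 ψ ^ 2 ∂σ =
      4 * ((d : ℝ) + 5) / (((d : ℝ) + 1) * (d + 2) * (d + 3)) := by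
  have h4 := hσ.integral_powerSum_four
  have h2 := hσ.integral_powerSum_two_sq_relation
  rw [hσ.integral_powerSum_two, hσ.integral_powerSum_three] at h2
  rw [hσ.integral_powerSum_three] at h4
  have hd' : (3 : ℝ) ≤ d := by exact_mod_cast hd
  set P := ∫ ψ, powerSum 2 ψ ^ 2 ∂σ
  have h : ((d : ℝ) - 2) * (d + 3) * P =
      (d + 4) * (2 * (2 / ((d : ℝ) + 1)) - 4 * (6 / (((d : ℝ) + 1) * (d + 2)))) +
        (d + 2) * (2 * (6 / (((d : ℝ) + 1) * (d + 2)))) := by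
    linear_combination ((d : ℝ) + 4) * h2 + ((d : ℝ) + 2) * h4
  rw [eq_div_iff (by positivity)]
  refine mul_left_cancel₀ (show ((d : ℝ) - 2) ≠ 0 by linarith) ?_
  field_simp at h
  linear_combination h

/-- The variance of the collision probability of a uniformly random state. -/
lemma IsUniformSphereMeasure.integral_powerSum_two_sub_sq_le {σ : Measure (unitSphere d)}
    (hσ : IsUniformSphereMeasure d σ) (hd : 3 ≤ d) :
    ∫ ψ, (powerSum 2 ψ - 2 / ((d : ℝ) + 1)) ^ 2 ∂σ ≤ 4 / (d : ℝ) ^ 3 := by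
  have := hσ.1
  have e : ∀ ψ : unitSphere d, (powerSum 2 ψ - 2 / ((d : ℝ) + 1)) ^ 2 =
      powerSum 2 ψ ^ 2 - (4 / ((d : ℝ) + 1)) * powerSum 2 ψ + 4 / ((d : ℝ) + 1) ^ 2 := fun ψ => by
    field_simp; ring
  simp only [e]
  rw [integral_add (Continuous.integrable_unitSphere (by fun_prop)) (integrable_const _),
    integral_sub (Continuous.integrable_unitSphere (by fun_prop))
    (Continuous.integrable_unitSphere (by fun_prop)), integral_const_mul,
    hσ.integral_powerSum_two, hσ.integral_powerSum_two_sq hd]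
  simp only [integral_const, probReal_univ, smul_eq_mul, one_mul]
  have hd' : (3 : ℝ) ≤ d := by exact_mod_cast hd
  have : 4 * ((d : ℝ) + 5) / (((d : ℝ) + 1) * (d + 2) * (d + 3)) -
      4 / ((d : ℝ) + 1) * (2 / ((d : ℝ) + 1)) + 4 / ((d : ℝ) + 1) ^ 2 =
      4 * ((d : ℝ) - 1) / (((d : ℝ) + 1) ^ 2 * ((d + 2) * (d + 3))) := by
    field_simp; ring
  rw [this, div_le_div_iff₀ (by positivity) (by positivity)]
  have h1 : ((d : ℝ) - 1) * d ^ 3 ≤ (d : ℝ) ^ 2 * (d * d) := by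
    nlinarith [pow_pos (by linarith : (0 : ℝ) < d) 3]
  have h2 : (d : ℝ) ^ 2 * (d * d) ≤ ((d : ℝ) + 1) ^ 2 * ((d + 2) * (d + 3)) := by
    gcongr <;> linarith
  linarith

end Moments

section Blocks

variable {X : Type*} {k t : ℕ}

/-- The pairs of sample positions compared within the blocks. -/
def blockPairs (k t : ℕ) : Finset ((Fin k × Fin t) × (Fin k × Fin t)) :=
  (Finset.univ ×ˢ Finset.univ.filter fun ij : Fin t × Fin t => ij.1 < ij.2).image
    fun e => ((e.1, e.2.1), (e.1, e.2.2))

lemma blockPairs_injective :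
    Function.Injective fun e : Fin k × (Fin t × Fin t) => ((e.1, e.2.1), (e.1, e.2.2)) := by
  rintro ⟨r, i, j⟩ ⟨r', i', j'⟩ h
  simp_all

lemma mem_blockPairs {e : (Fin k × Fin t) × (Fin k × Fin t)} :
    e ∈ blockPairs k t ↔ e.1.1 = e.2.1 ∧ e.1.2 < e.2.2 := by
  obtain ⟨⟨r, i⟩, ⟨r', j⟩⟩ := e
  simp only [blockPairs, Finset.mem_image, Finset.mem_product, Finset.mem_filter,
    Finset.mem_univ, true_and, Prod.exists, Prod.mk.injEq]
  constructor
  · rintro ⟨a, b, c, h, ⟨rfl, rfl⟩, rfl, rfl⟩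
    exact ⟨rfl, h⟩
  · rintro ⟨rfl, h⟩
    exact ⟨r, i, j, h, ⟨rfl, rfl⟩, rfl, rfl⟩

lemma card_filter_lt (t : ℕ) :
    (Finset.univ.filter fun ij : Fin t × Fin t => ij.1 < ij.2).card = t.choose 2 := by
  rw [Finset.card_filter, Fintype.sum_prod_type_right]
  have : ∀ j : Fin t, (∑ i : Fin t, if i < j then 1 else 0) = (j : ℕ) := fun j => by
    rw [← Finset.card_filter, Finset.filter_gt_eq_Iio, Fin.card_Iio]
  simp only [this]
  rw [Fin.sum_univ_eq_sum_range (fun i => i), Finset.sum_range_id, Nat.choose_two_right]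

lemma card_blockPairs (k t : ℕ) : (blockPairs k t).card = k * t.choose 2 := by
  rw [blockPairs, Finset.card_image_of_injective _ blockPairs_injective, Finset.card_product,
    card_filter_lt, Finset.card_univ, Fintype.card_fin]

lemma blockAvg_eq (ω : Fin k × Fin t → X) :
    blockAvg k t ω = (k : ℝ)⁻¹ * ∑ e ∈ blockPairs k t, collide e ω := by
  rw [blockAvg, blockPairs, Finset.sum_image blockPairs_injective.injOn, Finset.sum_product]
  congr 1
  refine Finset.sum_congr rfl fun r _ => ?_
  simp only [blockCollisions, collide]
  rw [Finset.sum_boole, Finset.filter_filter]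

/-- A pair shares a position with at most `4t` others. -/
lemma card_filter_shares_le {e : (Fin k × Fin t) × (Fin k × Fin t)} (he : e ∈ blockPairs k t) :
    ((blockPairs k t).filter fun f =>
      e.1 = f.1 ∨ e.1 = f.2 ∨ e.2 = f.1 ∨ e.2 = f.2).card ≤ 4 * t := by
  obtain ⟨⟨r, i⟩, ⟨r', j⟩⟩ := e
  obtain rfl : r = r' := (mem_blockPairs.1 he).1
  have hsub : ((blockPairs k t).filter fun f =>
      (r, i) = f.1 ∨ (r, i) = f.2 ∨ (r, j) = f.1 ∨ (r, j) = f.2) ⊆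
      (Finset.univ ×ˢ Finset.univ : Finset (Fin 4 × Fin t)).image fun a =>
        ![((r, i), (r, a.2)), ((r, a.2), (r, i)), ((r, j), (r, a.2)), ((r, a.2), (r, j))] a.1 := by
    rintro ⟨⟨s, i'⟩, ⟨s', j'⟩⟩ hf
    obtain ⟨hf, h⟩ := Finset.mem_filter.1 hf
    obtain rfl : s = s' := (mem_blockPairs.1 hf).1
    simp only [Finset.mem_image, Finset.mem_product, Finset.mem_univ, true_and, Prod.exists]
    simp only [Prod.mk.injEq] at h
    rcases h with ⟨rfl, rfl⟩ | ⟨rfl, rfl⟩ | ⟨rfl, rfl⟩ | ⟨rfl, rfl⟩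
    · exact ⟨0, j', rfl⟩
    · exact ⟨1, i', rfl⟩
    · exact ⟨2, j', rfl⟩
    · exact ⟨3, i', rfl⟩
  refine (Finset.card_le_card hsub).trans (Finset.card_image_le.trans ?_)
  simp

/-- Variance bound for the block average. -/
lemma integral_blockAvg_sub_sq_le [Fintype X] [MeasurableSpace X] [MeasurableSingletonClass X]
    (μ : Measure X) [IsProbabilityMeasure μ] (hk : 0 < k) :
    ∫ ω, (blockAvg k t ω - t.choose 2 * ∑ x, μ.real {x} ^ 2) ^ 2
        ∂(Measure.pi fun _ : Fin k × Fin t => μ) ≤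
      (k : ℝ)⁻¹ * (t.choose 2 * (∑ x, μ.real {x} ^ 2 + 4 * t * ∑ x, μ.real {x} ^ 3)) := by
  set p := ∑ x, μ.real {x} ^ 2 with hp
  set q := ∑ x, μ.real {x} ^ 3 with hq
  have hq0 : 0 ≤ q := Finset.sum_nonneg fun _ _ => by positivity
  have hk' : (k : ℝ) ≠ 0 := by positivity
  have key : ∀ ω : Fin k × Fin t → X, (blockAvg k t ω - t.choose 2 * p) ^ 2 =
      (k : ℝ)⁻¹ ^ 2 * ∑ e ∈ blockPairs k t, ∑ f ∈ blockPairs k t,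
        (collide e ω - p) * (collide f ω - p) := fun ω => by
    rw [← Finset.sum_mul_sum, Finset.sum_sub_distrib, Finset.sum_const, card_blockPairs,
      blockAvg_eq, nsmul_eq_mul]
    push_cast
    field_simp
  simp only [key]
  rw [integral_const_mul, integral_finsetSum _ fun _ _ => .of_finite]
  have hrow : ∀ e ∈ blockPairs k t, ∫ ω, ∑ f ∈ blockPairs k t,
      (collide e ω - p) * (collide f ω - p) ∂(Measure.pi fun _ : Fin k × Fin t => μ) ≤
      p + 4 * t * q := fun e he => by
    rw [integral_finsetSum _ fun _ _ => .of_finite]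
    have he' := mem_blockPairs.1 he
    calc _ ≤ ∑ f ∈ blockPairs k t, ((if f = e then p else 0) +
          (if e.1 = f.1 ∨ e.1 = f.2 ∨ e.2 = f.1 ∨ e.2 = f.2 then q else 0)) := by
          refine Finset.sum_le_sum fun f hf => ?_
          have hf' := mem_blockPairs.1 hf
          have he1 : e.1 ≠ e.2 := fun h => he'.2.ne (congrArg Prod.snd h)
          have hf1 : f.1 ≠ f.2 := fun h => hf'.2.ne (congrArg Prod.snd h)
          have hsw : ¬ (e.1 = f.2 ∧ e.2 = f.1) := fun ⟨h, h'⟩ =>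
            lt_asymm he'.2 (congrArg Prod.snd h ▸ congrArg Prod.snd h' ▸ hf'.2)
          refine (integral_centered_mul_le μ he1 hf1 hsw).trans_eq ?_
          congr
      _ ≤ p + 4 * t * q := by
          rw [Finset.sum_add_distrib, Finset.sum_ite_eq' _ _ fun _ => p, if_pos he,
            ← Finset.sum_filter, Finset.sum_const, nsmul_eq_mul]
          have := card_filter_shares_le he
          gcongr
          exact_mod_cast this
  calc _ ≤ (k : ℝ)⁻¹ ^ 2 * ∑ e ∈ blockPairs k t, (p + 4 * t * q) := by
        gcongr with e he
        exact hrow e he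
    _ = _ := by
        rw [Finset.sum_const, card_blockPairs, nsmul_eq_mul]
        push_cast
        field_simp

end Blocks

section Experiment

variable {d : ℕ}

lemma bornMeasure_singleton (ψ : unitSphere d) (x : Fin d) :
    bornMeasure d ψ {x} = ENNReal.ofReal (weight x ψ) := by
  rw [bornMeasure, Measure.sum_apply _ (measurableSet_singleton x), tsum_fintype,
    Finset.sum_eq_single x]
  · simp [weight]
  · intro y _ hy
    simp [hy]
  · simp

instance (ψ : unitSphere d) : IsProbabilityMeasure (bornMeasure d ψ) := by
  refine ⟨?_⟩
  rw [← Finset.coe_univ, ← sum_measure_singleton]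
  simp only [bornMeasure_singleton]
  rw [← ENNReal.ofReal_sum_of_nonneg fun x _ => weight_nonneg x ψ, sum_weight, ENNReal.ofReal_one]

lemma bornMeasure_real_singleton (ψ : unitSphere d) (x : Fin d) :
    (bornMeasure d ψ).real {x} = weight x ψ := by
  rw [measureReal_def, bornMeasure_singleton, ENNReal.toReal_ofReal (weight_nonneg x ψ)]

lemma measurable_pi_bornMeasure (ι : Type*) [Fintype ι] :
    Measurable fun ψ : unitSphere d => Measure.pi fun _ : ι => bornMeasure d ψ := by
  refine Measure.measurable_of_measurable_coe _ fun s _ => ?_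
  have : ∀ ψ : unitSphere d, (Measure.pi fun _ : ι => bornMeasure d ψ) s =
      ∑ ω ∈ s.toFinset, ∏ i, ENNReal.ofReal (weight (ω i) ψ) := fun ψ => by
    conv_lhs => rw [← Set.coe_toFinset s, ← sum_measure_singleton]
    simp only [Measure.pi_singleton, bornMeasure_singleton]
  simp only [this]
  exact Finset.measurable_fun_sum _ fun ω _ => Finset.measurable_fun_prod _ fun i _ =>
    (continuous_weight (ω i)).measurable.ennreal_ofReal

/-- Chebyshev bound for a fixed state. -/
lemma pi_bornMeasure_deviation_le {k : ℕ} (t : ℕ) (hk : 0 < k) (ψ : unitSphere d) (a : ℝ) :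
    (Measure.pi fun _ : Fin k × Fin t => bornMeasure d ψ)
        {ω | |blockAvg k t ω - t.choose 2 * a| ≤ 1 / 4}ᶜ ≤
      ENNReal.ofReal (32 * ((k : ℝ)⁻¹ * (t.choose 2 * (powerSum 2 ψ + 4 * t * powerSum 3 ψ)) +
        (t.choose 2 : ℝ) ^ 2 * (powerSum 2 ψ - a) ^ 2)) := by
  set ν := Measure.pi fun _ : Fin k × Fin t => bornMeasure d ψ
  have hvar := integral_blockAvg_sub_sq_le (t := t) (bornMeasure d ψ) hk
  simp only [bornMeasure_real_singleton] at hvar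
  change ∫ ω, (blockAvg k t ω - t.choose 2 * powerSum 2 ψ) ^ 2 ∂ν ≤
    (k : ℝ)⁻¹ * (t.choose 2 * (powerSum 2 ψ + 4 * t * powerSum 3 ψ)) at hvar
  have hcheb := mul_meas_ge_le_integral_of_nonneg (μ := ν)
    (f := fun ω => (blockAvg k t ω - t.choose 2 * a) ^ 2)
    (.of_forall fun _ => sq_nonneg _) .of_finite (1 / 16)
  have hle : ∫ ω, (blockAvg k t ω - t.choose 2 * a) ^ 2 ∂ν ≤
      2 * ∫ ω, (blockAvg k t ω - t.choose 2 * powerSum 2 ψ) ^ 2 ∂ν +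
        2 * ((t.choose 2 : ℝ) ^ 2 * (powerSum 2 ψ - a) ^ 2) := by
    calc _ ≤ ∫ ω, (2 * (blockAvg k t ω - t.choose 2 * powerSum 2 ψ) ^ 2 +
          2 * ((t.choose 2 : ℝ) ^ 2 * (powerSum 2 ψ - a) ^ 2)) ∂ν := by
          refine integral_mono .of_finite .of_finite fun ω => ?_
          have := sq_nonneg ((blockAvg k t ω - t.choose 2 * powerSum 2 ψ) -
            t.choose 2 * (powerSum 2 ψ - a))
          dsimp only
          linarith
      _ = _ := by
          rw [integral_add .of_finite .of_finite, integral_const_mul]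
          simp
  have hsub : {ω : Fin k × Fin t → Fin d | |blockAvg k t ω - t.choose 2 * a| ≤ 1 / 4}ᶜ ⊆
      {ω | 1 / 16 ≤ (blockAvg k t ω - t.choose 2 * a) ^ 2} := fun ω hω => by
    simp only [Set.mem_compl_iff, Set.mem_ofPred_eq, not_le] at hω ⊢
    rw [← sq_abs]
    nlinarith
  refine (measure_mono hsub).trans ?_
  rw [← ofReal_measureReal]
  exact ENNReal.ofReal_le_ofReal (by linarith)

lemma IsUniformSphereMeasure.bind_deviation_le {σ : Measure (unitSphere d)}
    (hσ : IsUniformSphereMeasure d σ) (hd : 3 ≤ d) {k : ℕ} (t : ℕ) (hk : 0 < k) :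
    (σ.bind fun ψ => Measure.pi fun _ : Fin k × Fin t => bornMeasure d ψ)
        {ω | |blockAvg k t ω - t.choose 2 * (2 / ((d : ℝ) + 1))| ≤ 1 / 4}ᶜ ≤
      ENNReal.ofReal (32 * ((k : ℝ)⁻¹ * (t.choose 2 * (2 / ((d : ℝ) + 1) +
        4 * t * (6 / (((d : ℝ) + 1) * (d + 2))))) + (t.choose 2 : ℝ) ^ 2 * (4 / (d : ℝ) ^ 3))) := by
  have := hσ.1
  rw [Measure.bind_apply (Set.toFinite _).measurableSet (measurable_pi_bornMeasure _).aemeasurable]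
  refine (lintegral_mono fun ψ => pi_bornMeasure_deviation_le t hk ψ _).trans ?_
  rw [← ofReal_integral_eq_lintegral_ofReal (Continuous.integrable_unitSphere (by fun_prop))]
  · refine ENNReal.ofReal_le_ofReal ?_
    rw [integral_const_mul, integral_add (Continuous.integrable_unitSphere (by fun_prop))
      (Continuous.integrable_unitSphere (by fun_prop)), integral_const_mul, integral_const_mul,
      integral_const_mul, integral_add (Continuous.integrable_unitSphere (by fun_prop))
      (Continuous.integrable_unitSphere (by fun_prop)), integral_const_mul,
      hσ.integral_powerSum_two, hσ.integral_powerSum_three]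
    gcongr
    exact hσ.integral_powerSum_two_sub_sq_le hd
  · have hn : ∀ (n : ℕ) (ψ : unitSphere d), 0 ≤ powerSum n ψ := fun n ψ =>
      Finset.sum_nonneg fun x _ => pow_nonneg (weight_nonneg x ψ) n
    refine .of_forall fun ψ => ?_
    have h2 := hn 2 ψ
    have h3 := hn 3 ψ
    simp only [Pi.zero_apply]
    positivity

lemma deviation_bound_le {d : ℕ} (hd : 1000000 ≤ d) :
    32 * (((100000 : ℕ) : ℝ)⁻¹ * (⌈√(d : ℝ)⌉₊.choose 2 * (2 / ((d : ℝ) + 1) +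
      4 * ⌈√(d : ℝ)⌉₊ * (6 / (((d : ℝ) + 1) * (d + 2))))) +
      (⌈√(d : ℝ)⌉₊.choose 2 : ℝ) ^ 2 * (4 / (d : ℝ) ^ 3)) ≤ 1 / 100 := by
  have hd' : (1000000 : ℝ) ≤ d := by exact_mod_cast hd
  have hs : (1000 : ℝ) ≤ √d := Real.le_sqrt_of_sq_le (by norm_num; linarith)
  have hsq : √(d : ℝ) ^ 2 = d := Real.sq_sqrt (by positivity)
  have ht := (Nat.ceil_lt_add_one (Real.sqrt_nonneg (d : ℝ))).le
  have ht0 : √(d : ℝ) ≤ ⌈√(d : ℝ)⌉₊ := Nat.le_ceil _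
  rw [Nat.cast_choose_two]
  set t : ℝ := (⌈√(d : ℝ)⌉₊ : ℝ)
  have hC0 : 0 ≤ t * (t - 1) / 2 := by nlinarith
  have hC : t * (t - 1) / 2 ≤ d := by nlinarith
  set C := t * (t - 1) / 2
  have htd : 24 * t ≤ d := by nlinarith
  have h1 : 2 / ((d : ℝ) + 1) ≤ 2 / d := by gcongr; linarith
  have h2 : 4 * t * (6 / (((d : ℝ) + 1) * (d + 2))) ≤ 1 / d := by
    rw [← mul_div_assoc, div_le_div_iff₀ (by positivity) (by positivity)]
    nlinarith
  have h3 : C * (2 / ((d : ℝ) + 1) + 4 * t * (6 / (((d : ℝ) + 1) * (d + 2)))) ≤ 3 := by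
    calc _ ≤ (d : ℝ) * (2 / d + 1 / d) := by gcongr
      _ = 3 := by field_simp; norm_num
  have h4 : C ^ 2 * (4 / (d : ℝ) ^ 3) ≤ 4 / 1000000 := by
    calc _ ≤ (d : ℝ) ^ 2 * (4 / (d : ℝ) ^ 3) := by gcongr
      _ = 4 / d := by field_simp
      _ ≤ _ := by gcongr
  norm_num at h3 h4 ⊢
  linarith

end Experiment

/-- For `t = ⌈√d⌉` and `k = 100000`: sampling a uniformly random state `ψ` on the unit sphere of
`ℂ^d` and then `kt` i.i.d. Born samples, the block-averaged collision count `M` satisfies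
`|M - C(t,2)·2/(d+1)| ≤ 1/4` with probability at least `0.99`, for all sufficiently large `d`. -/
theorem haar_collision_test :
    ∃ d₀ : ℕ, ∀ d : ℕ, d₀ ≤ d →
      ∀ σ : Measure (unitSphere d), IsUniformSphereMeasure d σ →
        ENNReal.ofReal (99 / 100) ≤
          (σ.bind fun ψ =>
              Measure.pi fun _ : Fin 100000 × Fin ⌈Real.sqrt d⌉₊ => bornMeasure d ψ)
            {ω | |blockAvg 100000 ⌈Real.sqrt d⌉₊ ω -
                ((⌈Real.sqrt d⌉₊.choose 2 : ℝ) * (2 / ((d : ℝ) + 1)))| ≤ 1 / 4} := by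
  refine ⟨1000000, fun d hd σ hσ => ?_⟩
  have := hσ.1
  have hprob := isProbabilityMeasure_bind (m := σ)
    (measurable_pi_bornMeasure (d := d) (Fin 100000 × Fin ⌈√(d : ℝ)⌉₊)).aemeasurable
    (.of_forall fun ψ => inferInstance)
  have hbad := (hσ.bind_deviation_le (by omega) (k := 100000) ⌈√(d : ℝ)⌉₊ (by norm_num)).trans
    (ENNReal.ofReal_le_ofReal (deviation_bound_le hd))
  rw [prob_compl_eq_one_sub (Set.toFinite _).measurableSet, tsub_le_iff_right] at hbad
  have h1 : ENNReal.ofReal (1 / 100) + ENNReal.ofReal (99 / 100) = 1 := by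
    rw [← ENNReal.ofReal_add (by norm_num) (by norm_num)]
    norm_num
  rw [← h1] at hbad
  exact (ENNReal.add_le_add_iff_left ENNReal.ofReal_ne_top).1 hbad
end
end

section
/- For every natural number n ≥ 1, the ratio of the count 2^{n(n−1)/2}·2^{2n} of full-support stabilizer states constructed in the paper to the total count 2^n·∏_{j=1}^n (2^j + 1) of n-qubit stabilizer states satisfies the identity and bound: (2^{n(n−1)/2}·2^{2n}) / (2^n·∏_{j=1}^n (2^j + 1)) = ∏_{j=1}^n 1/(1 + 2^{−j}) ≥ e^{−1}. -/
open Finset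

/-- The product `a * a^2 * ⋯ * a^n` as a single power of `a`. -/
theorem prod_Icc_one_pow {M : Type*} [CommMonoid M] (a : M) (n : ℕ) :
    ∏ j ∈ Finset.Icc 1 n, a ^ j = a ^ (n * (n - 1) / 2 + n) := by
  rw [Finset.prod_pow_eq_pow_sum, ← Finset.sum_range_id, ← Finset.sum_range_succ (fun i => i)]
  congr 1
  rw [Finset.range_eq_Ico, Finset.sum_eq_sum_Ico_succ_bot n.succ_pos]
  simp only [zero_add]
  rfl

theorem sum_Icc_one_inv_two_pow (n : ℕ) :
    ∑ j ∈ Finset.Icc 1 n, ((2 : ℝ) ^ j)⁻¹ = 1 - ((2 : ℝ) ^ n)⁻¹ := by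
  induction n with
  | zero => simp
  | succ n ih =>
    rw [Finset.sum_Icc_succ_top (by omega), ih, pow_succ, mul_inv]
    ring

theorem prod_one_add_inv_two_pow_le_exp_one (n : ℕ) :
    ∏ j ∈ Finset.Icc 1 n, (1 + ((2 : ℝ) ^ j)⁻¹) ≤ Real.exp 1 := by
  calc ∏ j ∈ Finset.Icc 1 n, (1 + ((2 : ℝ) ^ j)⁻¹)
      ≤ ∏ j ∈ Finset.Icc 1 n, Real.exp ((2 : ℝ) ^ j)⁻¹ :=
        Finset.prod_le_prod (fun _ _ => by positivity) fun j _ => by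
          rw [add_comm]; exact Real.add_one_le_exp _
    _ = Real.exp (1 - ((2 : ℝ) ^ n)⁻¹) := by
        rw [← Real.exp_sum, sum_Icc_one_inv_two_pow]
    _ ≤ Real.exp 1 := Real.exp_le_exp.2 (sub_le_self _ (by positivity))

/-- The ratio of the count of the full-support stabilizer states constructed in the paper to the
total count of `n`-qubit stabilizer states equals `∏_{j=1}^n 1/(1+2^{-j})`, which is at least
`e⁻¹`. -/
theorem stabilizer_ratio (n : ℕ) (hn : 1 ≤ n) :
    ((2 : ℝ) ^ (n * (n - 1) / 2) * 2 ^ (2 * n)) /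
        ((2 : ℝ) ^ n * ∏ j ∈ Finset.Icc 1 n, ((2 : ℝ) ^ j + 1))
      = ∏ j ∈ Finset.Icc 1 n, (1 + ((2 : ℝ) ^ j)⁻¹)⁻¹ ∧
    Real.exp (-1) ≤ ∏ j ∈ Finset.Icc 1 n, (1 + ((2 : ℝ) ^ j)⁻¹)⁻¹ := by
  rw [Finset.prod_inv_distrib]
  constructor
  · have hfactor : ∏ j ∈ Finset.Icc 1 n, ((2 : ℝ) ^ j + 1) =
        2 ^ (n * (n - 1) / 2 + n) * ∏ j ∈ Finset.Icc 1 n, (1 + ((2 : ℝ) ^ j)⁻¹) := by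
      rw [← prod_Icc_one_pow, ← Finset.prod_mul_distrib]
      exact Finset.prod_congr rfl fun j _ => by field_simp
    have hpos : 0 < ∏ j ∈ Finset.Icc 1 n, (1 + ((2 : ℝ) ^ j)⁻¹) :=
      Finset.prod_pos fun _ _ => by positivity
    rw [hfactor, div_eq_iff (by positivity), pow_add, two_mul, pow_add]
    field_simp
  · rw [Real.exp_neg]
    exact inv_anti₀ (Finset.prod_pos fun _ _ => by positivity)
      (prod_one_add_inv_two_pow_le_exp_one n)
end
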